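/- For every t ∈ {1, …, T}, every e ∈ {0, …, K}, and all nonempty bounded sets G, H ⊆ ℝⁿ with r*(G) = r*(H), one has V_t(G, e) = V_t(H, e) and W_t(G, e) = W_t(H, e) (the value functions satisfy property Q). -/

import Mathlib

noncomputable section

abbrev Euc (n : ℕ) := EuclideanSpace ℝ (Fin n)

variable {n : ℕ}

/-- Chebyshev radius of a set `S ⊆ ℝⁿ`: `r*(S) = inf_x sup_{y ∈ S} ‖y − x‖`. -/
def rad {n : ℕ} (S : Set (Euc n)) : ℝ :=
  ⨅ x : Euc n, sSup {c : ℝ | ∃ y ∈ S, c = ‖y - x‖}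

/-- `φ_a(S) = {λ A x + w : x ∈ S, ‖w‖ ≤ a}`. -/
def phiSet (lam : ℝ) (A : Euc n ≃ₗᵢ[ℝ] Euc n) (a : ℝ) (S : Set (Euc n)) :
    Set (Euc n) :=
  {z | ∃ x ∈ S, ∃ w : Euc n, ‖w‖ ≤ a ∧ z = lam • A x + w}

/-- `ψ(θ, γ, x) = {x}` if `γ(x) = 1, and `{z ∈ θ : γ(z) = 0}` if `γ(x) = 0`. -/
def psiSet (θ : Set (Euc n)) (γ : Euc n → Bool) (x : Euc n) : Set (Euc n) :=
  if γ x then {x} else {z ∈ θ | γ z = false}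

/-- The worst-case cost `sup_{x ∈ θ} V(ψ(θ, γ, x), e − γ(x))` of using
prescription `γ`, given the current value function `V`. -/
def prescCost (V : Set (Euc n) → ℕ → ℝ) (θ : Set (Euc n)) (e : ℕ)
    (γ : Euc n → Bool) : ℝ :=
  sSup {c : ℝ | ∃ x ∈ θ, c = V (psiSet θ γ x) (e - (if γ x then 1 else 0))}

/-- `W(θ, e)`: the infimum over prescriptions (required to be identically `0`
when `e = 0`) of their worst-case cost, given the current value function `V`. -/
def Wfrom (V : Set (Euc n) → ℕ → ℝ) (θ : Set (Euc n)) (e : ℕ) : ℝ :=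
  sInf {r : ℝ | ∃ γ : Euc n → Bool, (e = 0 → ∀ x, γ x = false) ∧
    r = prescCost V θ e γ}

/-- Value functions `V`, indexed by the number `k` of remaining steps, so that
`Vv lam A a T k` is `V_t` for the paper time `t = T − k`:
`V_T(π, e) = r*(π)` and `V_t(π, e) = max( r*(π), W_{t+1}(φ_{a_{t+1}}(π), e) )`
(0-indexed radii: `a i` is the paper's `a_{i+1}`). -/
def Vv (lam : ℝ) (A : Euc n ≃ₗᵢ[ℝ] Euc n) (a : ℕ → ℝ) (T : ℕ) :
    ℕ → Set (Euc n) → ℕ → ℝ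
  | 0 => fun π _ => rad π
  | k + 1 => fun π e =>
      max (rad π) (Wfrom (Vv lam A a T k) (phiSet lam A (a (T - 1 - k)) π) e)



lemma norm_dist_bddAbove {S : Set (Euc n)} (hS : Bornology.IsBounded S) (x : Euc n) :
    BddAbove {c : ℝ | ∃ y ∈ S, c = ‖y - x‖} := by
  obtain ⟨C, hC⟩ := hS.exists_norm_le
  refine ⟨C + ‖x‖, ?_⟩
  rintro c ⟨y, hy, rfl⟩
  have h := norm_sub_le y x
  linarith [hC y hy]

lemma sSup_norm_sub_nonneg (S : Set (Euc n)) (x : Euc n) :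
    0 ≤ sSup {c : ℝ | ∃ y ∈ S, c = ‖y - x‖} := by
  apply Real.sSup_nonneg
  rintro c ⟨y, _, rfl⟩
  exact norm_nonneg _

lemma rad_singleton (x : Euc n) : rad {x} = 0 := by
  apply le_antisymm
  · have h : ⨅ z : Euc n, sSup {c : ℝ | ∃ y ∈ ({x} : Set (Euc n)), c = ‖y - z‖} ≤
        sSup {c : ℝ | ∃ y ∈ ({x} : Set (Euc n)), c = ‖y - x‖} := by
      refine ciInf_le ⟨0, ?_⟩ x
      rintro _ ⟨z, rfl⟩
      exact sSup_norm_sub_nonneg _ z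
    refine h.trans (Real.sSup_le ?_ le_rfl)
    rintro c ⟨y, rfl, rfl⟩
    simp
  · exact Real.iInf_nonneg fun z => sSup_norm_sub_nonneg _ z

lemma phiSet_nonempty (lam : ℝ) (A : Euc n ≃ₗᵢ[ℝ] Euc n) {a : ℝ} (ha : 0 ≤ a)
    {S : Set (Euc n)} (hS : S.Nonempty) : (phiSet lam A a S).Nonempty := by
  obtain ⟨x, hx⟩ := hS
  exact ⟨lam • A x + 0, x, hx, 0, by simpa using ha, rfl⟩

lemma phiSet_isBounded (lam : ℝ) (A : Euc n ≃ₗᵢ[ℝ] Euc n) (a : ℝ)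
    {S : Set (Euc n)} (hS : Bornology.IsBounded S) :
    Bornology.IsBounded (phiSet lam A a S) := by
  obtain ⟨C, hC⟩ := hS.exists_norm_le
  refine isBounded_iff_forall_norm_le.2 ⟨|lam| * C + a, ?_⟩
  rintro z ⟨x, hx, w, hw, rfl⟩
  refine (norm_add_le _ _).trans (add_le_add ?_ hw)
  rw [norm_smul, A.norm_map, Real.norm_eq_abs]
  exact mul_le_mul_of_nonneg_left (hC x hx) (abs_nonneg _)

lemma exists_norm_add_eq {E : Type*} [NormedAddCommGroup E] [NormedSpace ℝ E] [Nontrivial E]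
    (v : E) {a : ℝ} (ha : 0 ≤ a) : ∃ w : E, ‖w‖ ≤ a ∧ ‖v + w‖ = ‖v‖ + a := by
  by_cases hv : v = 0
  · obtain ⟨w, hw⟩ := exists_norm_eq E ha
    exact ⟨w, hw.le, by simp [hv, hw]⟩
  · have hv' : ‖v‖ ≠ 0 := norm_ne_zero_iff.2 hv
    have hc : 0 ≤ a / ‖v‖ := by positivity
    refine ⟨(a / ‖v‖) • v, ?_, ?_⟩
    · rw [norm_smul, Real.norm_of_nonneg hc, div_mul_cancel₀ _ hv']
    · rw [(SameRay.sameRay_nonneg_smul_right v hc).norm_add, norm_smul,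
        Real.norm_of_nonneg hc, div_mul_cancel₀ _ hv']

lemma sSup_norm_sub_phiSet [Nontrivial (Euc n)] {lam : ℝ} (hlam : lam ≠ 0)
    (A : Euc n ≃ₗᵢ[ℝ] Euc n) {a : ℝ} (ha : 0 ≤ a) {S : Set (Euc n)} (hS : S.Nonempty)
    (hSb : Bornology.IsBounded S) (x : Euc n) :
    sSup {c : ℝ | ∃ y ∈ phiSet lam A a S, c = ‖y - lam • A x‖} =
      |lam| * sSup {c : ℝ | ∃ y ∈ S, c = ‖y - x‖} + a := by
  have hpos : 0 < |lam| := abs_pos.2 hlam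
  have hnorm (y : Euc n) : ‖lam • A y - lam • A x‖ = |lam| * ‖y - x‖ := by
    rw [← smul_sub, ← map_sub, norm_smul, A.norm_map, Real.norm_eq_abs]
  apply le_antisymm
  · obtain ⟨p, hp⟩ := phiSet_nonempty lam A ha hS
    refine csSup_le ⟨_, p, hp, rfl⟩ ?_
    rintro c ⟨z, ⟨y, hy, w, hw, rfl⟩, rfl⟩
    rw [add_sub_right_comm]
    refine (norm_add_le _ _).trans (add_le_add ?_ hw)
    rw [hnorm]
    exact mul_le_mul_of_nonneg_left
      (le_csSup (norm_dist_bddAbove hSb x) ⟨y, hy, rfl⟩) hpos.le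
  · obtain ⟨q, hq⟩ := hS
    rw [← le_sub_iff_add_le, ← le_div_iff₀' hpos]
    refine csSup_le ⟨_, q, hq, rfl⟩ ?_
    rintro c ⟨y, hy, rfl⟩
    rw [le_div_iff₀' hpos, le_sub_iff_add_le, ← hnorm]
    obtain ⟨w, hw, hvw⟩ := exists_norm_add_eq (lam • A y - lam • A x) ha
    refine le_csSup (norm_dist_bddAbove (phiSet_isBounded lam A a hSb) _)
      ⟨lam • A y + w, ⟨y, hy, w, hw, rfl⟩, ?_⟩
    rw [← hvw, add_sub_right_comm]

lemma rad_phiSet [Nontrivial (Euc n)] {lam : ℝ} (hlam : lam ≠ 0)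
    (A : Euc n ≃ₗᵢ[ℝ] Euc n) {a : ℝ} (ha : 0 ≤ a) {S : Set (Euc n)} (hS : S.Nonempty)
    (hSb : Bornology.IsBounded S) : rad (phiSet lam A a S) = |lam| * rad S + a := by
  have hsurj : Function.Surjective fun x : Euc n => lam • A x := fun y =>
    ⟨A.symm (lam⁻¹ • y), by simp [smul_smul, hlam]⟩
  unfold rad
  rw [← hsurj.iInf_comp]
  simp only [sSup_norm_sub_phiSet hlam A ha hS hSb]
  rw [Real.mul_iInf_of_nonneg (abs_nonneg lam), ciInf_add]
  refine ⟨0, ?_⟩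
  rintro _ ⟨x, rfl⟩
  exact mul_nonneg (abs_nonneg _) (sSup_norm_sub_nonneg S x)

lemma rad_phiSet_congr [Nontrivial (Euc n)] (lam : ℝ) (A : Euc n ≃ₗᵢ[ℝ] Euc n) {a : ℝ}
    (ha : 0 ≤ a) {G H : Set (Euc n)} (hG : G.Nonempty) (hH : H.Nonempty)
    (hGb : Bornology.IsBounded G) (hHb : Bornology.IsBounded H) (hr : rad G = rad H) :
    rad (phiSet lam A a G) = rad (phiSet lam A a H) := by
  by_cases hlam : lam = 0
  · obtain ⟨g, hg⟩ := hG
    obtain ⟨h, hh⟩ := hH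
    congr 1
    ext z
    subst hlam
    constructor
    · rintro ⟨_, _, w, hw, rfl⟩
      exact ⟨h, hh, w, hw, by simp⟩
    · rintro ⟨_, _, w, hw, rfl⟩
      exact ⟨g, hg, w, hw, by simp⟩
  · rw [rad_phiSet hlam A ha hG hGb, rad_phiSet hlam A ha hH hHb, hr]

lemma prescCost_of_forall_false (V : Set (Euc n) → ℕ → ℝ) {θ : Set (Euc n)}
    (hθ : θ.Nonempty) (e : ℕ) {γ : Euc n → Bool} (hγ : ∀ x ∈ θ, γ x = false) :
    prescCost V θ e γ = V θ e := by
  obtain ⟨x, hx⟩ := hθ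
  have hset : {z ∈ θ | γ z = false} = θ := Set.sep_eq_self_iff_mem_true.2 hγ
  have : {c : ℝ | ∃ x ∈ θ, c = V (psiSet θ γ x) (e - (if γ x then 1 else 0))} = {V θ e} := by
    ext c
    constructor
    · rintro ⟨y, hy, rfl⟩
      simp [psiSet, hγ y hy, hset]
    · rintro rfl
      exact ⟨x, hx, by simp [psiSet, hγ x hx, hset]⟩
  rw [prescCost, this, csSup_singleton]

lemma prescCost_const_true (V : Set (Euc n) → ℕ → ℝ) {θ : Set (Euc n)}
    (hθ : θ.Nonempty) (e : ℕ) (hV : ∀ x, V {x} (e - 1) = V {0} (e - 1)) :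
    prescCost V θ e (fun _ => true) = V {0} (e - 1) := by
  obtain ⟨x, hx⟩ := hθ
  have : {c : ℝ | ∃ x ∈ θ, c = V (psiSet θ (fun _ => true) x)
      (e - (if (fun _ : Euc n => true) x then 1 else 0))} = {V {0} (e - 1)} := by
    ext c
    constructor
    · rintro ⟨y, hy, rfl⟩
      simp [psiSet, hV y]
    · rintro rfl
      exact ⟨x, hx, by simp [psiSet, hV x]⟩
  rw [prescCost, this, csSup_singleton]

lemma le_prescCost (V : Set (Euc n) → ℕ → ℝ) {θ : Set (Euc n)} (e : ℕ)
    (hV : ∀ x, V {x} (e - 1) = V {0} (e - 1)) {γ : Euc n → Bool}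
    {x : Euc n} (hx : x ∈ θ) (hγ : γ x = true) :
    V {0} (e - 1) ≤ prescCost V θ e γ := by
  refine le_csSup ⟨max (V {0} (e - 1)) (V {z ∈ θ | γ z = false} e), ?_⟩
    ⟨x, hx, by simp [psiSet, hγ, hV x]⟩
  rintro c ⟨y, -, rfl⟩
  cases h : γ y
  · simp [psiSet, h]
  · simp [psiSet, h, hV y]

lemma Wfrom_zero (V : Set (Euc n) → ℕ → ℝ) {θ : Set (Euc n)} (hθ : θ.Nonempty) :
    Wfrom V θ 0 = V θ 0 := by
  have : {r : ℝ | ∃ γ : Euc n → Bool, ((0 : ℕ) = 0 → ∀ x, γ x = false) ∧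
      r = prescCost V θ 0 γ} = {V θ 0} := by
    ext r
    constructor
    · rintro ⟨γ, hγ, rfl⟩
      exact prescCost_of_forall_false V hθ 0 fun x _ => hγ rfl x
    · rintro rfl
      exact ⟨fun _ => false, fun _ _ => rfl,
        (prescCost_of_forall_false V hθ 0 fun _ _ => rfl).symm⟩
  rw [Wfrom, this, csInf_singleton]

/-- With budget left, the optimum is to transmit always or never. -/
lemma Wfrom_of_ne_zero (V : Set (Euc n) → ℕ → ℝ) {θ : Set (Euc n)} (hθ : θ.Nonempty)
    {e : ℕ} (he : e ≠ 0) (hV : ∀ x, V {x} (e - 1) = V {0} (e - 1)) :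
    Wfrom V θ e = min (V θ e) (V {0} (e - 1)) := by
  have hlb : min (V θ e) (V {0} (e - 1)) ∈ lowerBounds {r : ℝ | ∃ γ : Euc n → Bool,
      (e = 0 → ∀ x, γ x = false) ∧ r = prescCost V θ e γ} := by
    rintro r ⟨γ, -, rfl⟩
    by_cases h : ∃ x ∈ θ, γ x = true
    · obtain ⟨x, hx, hγ⟩ := h
      exact (min_le_right _ _).trans (le_prescCost V e hV hx hγ)
    · rw [prescCost_of_forall_false V hθ e fun x hx => by
        simpa using fun hγ => h ⟨x, hx, hγ⟩]
      exact min_le_left _ _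
  apply IsLeast.csInf_eq
  refine ⟨?_, hlb⟩
  rcases min_choice (V θ e) (V {0} (e - 1)) with h | h
  · rw [h]
    exact ⟨fun _ => false, fun _ _ => rfl,
      (prescCost_of_forall_false V hθ e fun _ _ => rfl).symm⟩
  · rw [h]
    exact ⟨fun _ => true, fun h0 => absurd h0 he, (prescCost_const_true V hθ e hV).symm⟩

/-- Property Q: the value depends on a nonempty bounded set only through its Chebyshev radius. -/
def DependsOnRad (V : Set (Euc n) → ℕ → ℝ) : Prop :=
  ∀ (e : ℕ) (G H : Set (Euc n)), G.Nonempty → H.Nonempty → Bornology.IsBounded G →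
    Bornology.IsBounded H → rad G = rad H → V G e = V H e

lemma DependsOnRad.Wfrom {V : Set (Euc n) → ℕ → ℝ} (hV : DependsOnRad V) :
    DependsOnRad (Wfrom V) := by
  intro e G H hG hH hGb hHb hr
  have hGH := hV e G H hG hH hGb hHb hr
  rcases eq_or_ne e 0 with rfl | he
  · rw [Wfrom_zero V hG, Wfrom_zero V hH, hGH]
  · have hpt (x : Euc n) : V {x} (e - 1) = V {0} (e - 1) :=
      hV _ _ _ (Set.singleton_nonempty x) (Set.singleton_nonempty 0)
        Bornology.isBounded_singleton Bornology.isBounded_singleton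
        (by rw [rad_singleton, rad_singleton])
    rw [Wfrom_of_ne_zero V hG he hpt, Wfrom_of_ne_zero V hH he hpt, hGH]

lemma dependsOnRad_Vv [Nontrivial (Euc n)] (lam : ℝ) (A : Euc n ≃ₗᵢ[ℝ] Euc n)
    (a : ℕ → ℝ) (ha : ∀ t, 0 ≤ a t) (T k : ℕ) : DependsOnRad (Vv lam A a T k) := by
  induction k with
  | zero => exact fun _ _ _ _ _ _ _ hr => hr
  | succ k ih =>
    intro e G H hG hH hGb hHb hr
    simp only [Vv]
    rw [hr, ih.Wfrom e _ _ (phiSet_nonempty lam A (ha _) hG) (phiSet_nonempty lam A (ha _) hH)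
      (phiSet_isBounded lam A _ hGb) (phiSet_isBounded lam A _ hHb)
      (rad_phiSet_congr lam A (ha _) hG hH hGb hHb hr)]

/-- the value functions `V_t` and `W_t` satisfy property Q: they
agree on nonempty bounded sets with equal Chebyshev radii.  (Paper time
`t ∈ {1,…,T}` corresponds to `Vv lam A a T (T − t)`; below `t` is 0-indexed,
i.e. `t < T` and the paper's `V_{t+1}` is `Vv lam A a T (T − 1 − t)`.) -/
theorem stmt7 {n : ℕ} (hn : 1 ≤ n) (lam : ℝ) (A : Euc n ≃ₗᵢ[ℝ] Euc n)
    (T K : ℕ) (hT : 1 ≤ T) (hK : 1 ≤ K)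
    (a : ℕ → ℝ) (ha : ∀ t, 0 ≤ a t)
    (t e : ℕ) (ht : t < T) (he : e ≤ K)
    (G H : Set (Euc n)) (hG : G.Nonempty) (hH : H.Nonempty)
    (hGb : Bornology.IsBounded G) (hHb : Bornology.IsBounded H)
    (hr : rad G = rad H) :
    Vv lam A a T (T - 1 - t) G e = Vv lam A a T (T - 1 - t) H e ∧
    Wfrom (Vv lam A a T (T - 1 - t)) G e = Wfrom (Vv lam A a T (T - 1 - t)) H e := by
  have : Nonempty (Fin n) := ⟨⟨0, hn⟩⟩
  have hV := dependsOnRad_Vv lam A a ha T (T - 1 - t)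
  exact ⟨hV e G H hG hH hGb hHb hr, hV.Wfrom e G H hG hH hGb hHb hr⟩
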